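/- Let ρ̂ ∈ ℝ³ be a unit vector with ⟨ρ̂, e₃⟩ = 0, let T_ρ, T_z, ρ, z ∈ ℝ with (ρ, z) ≠ (0, 0), and set T = T_ρ·ρ̂ + T_z·e₃ and x = ρ·ρ̂ + z·e₃. Let D_c = R_{[x, x/2]}(0) and N_D = R_{[x,0]}(−e₃). Then there exists t ∈ ℝ with T = D_c + t·N_D if and only if ρ³ + ρz² + T_ρ(z² − ρ²) − 2T_z·ρz = 0. -/

import Mathlib

open RealInnerProductSpace

noncomputable section

/-- ℝ³ with the Euclidean inner product and norm. -/
abbrev E3 := EuclideanSpace ℝ (Fin 3)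

/-- The standard basis vector e₃ = (0,0,1). -/
def e3 : E3 := EuclideanSpace.single 2 1

/-- Reflection over the plane `{x | ⟪N, x - q⟫ = 0}`:
`R_{[N,q]}(a) = a − 2(⟪N, a − q⟫/‖N‖²) • N`. -/
def refl3 (N q a : E3) : E3 := a - (2 * ⟪N, a - q⟫ / ‖N‖ ^ 2) • N

/-- The nonpositive part of the z-axis, `Z≤0`. -/
def Zneg : Set E3 := {x | ∃ t : ℝ, t ≤ 0 ∧ x = t • e3}

/-- The nonnegative part of the z-axis, `Z≥0`. -/
def Zpos : Set E3 := {x | ∃ t : ℝ, 0 ≤ t ∧ x = t • e3}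

/-- **Affine pointing locus.** The point `x = ρ • ρ̂ + z • e₃ ≠ 0` is a distal center
whose pointing axis contains `T = T_ρ • ρ̂ + T_z • e₃` iff `E_T(ρ, z) = 0`, where
`E_T(ρ, z) = ρ³ + ρz² + T_ρ(z² − ρ²) − 2T_z ρz`. -/
theorem affine_pointing_locus (ρhat : E3) (hρ : ‖ρhat‖ = 1) (hperp : ⟪ρhat, e3⟫ = 0)
    (Tρ Tz ρ z : ℝ) (hx : (ρ, z) ≠ (0, 0)) :
    let T := Tρ • ρhat + Tz • e3
    let x := ρ • ρhat + z • e3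
    (∃ t : ℝ, T = refl3 x ((1/2 : ℝ) • x) 0 + t • refl3 x 0 (-e3)) ↔
      ρ ^ 3 + ρ * z ^ 2 + Tρ * (z ^ 2 - ρ ^ 2) - 2 * Tz * ρ * z = 0 := by
  intro T x
  have hs : 0 < ρ ^ 2 + z ^ 2 := by
    by_contra h
    apply hx
    have h1 : ρ = 0 := by nlinarith [sq_nonneg ρ, sq_nonneg z]
    have h2 : z = 0 := by nlinarith [sq_nonneg ρ, sq_nonneg z]
    rw [h1, h2]
  have hs0 := hs.ne'
  have hee : ⟪e3, e3⟫ = (1 : ℝ) := by simp [e3]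
  have hrr : ⟪ρhat, ρhat⟫ = (1 : ℝ) := by rw [real_inner_self_eq_norm_sq, hρ]; norm_num
  have hperp' : ⟪e3, ρhat⟫ = (0 : ℝ) := by rw [real_inner_comm]; exact hperp
  have hxx : ⟪x, x⟫ = ρ ^ 2 + z ^ 2 := by
    simp only [x, inner_add_left, inner_add_right, real_inner_smul_left, real_inner_smul_right,
      hee, hrr, hperp, hperp']
    ring
  have hn : ‖x‖ ^ 2 = ρ ^ 2 + z ^ 2 := by rw [← real_inner_self_eq_norm_sq, hxx]
  have hxe : ⟪x, e3⟫ = z := by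
    simp only [x, inner_add_left, real_inner_smul_left, hee, hperp]
    ring
  have hD : refl3 x ((1/2 : ℝ) • x) 0 = x := by
    have hc : 2 * (-(1 / 2 * (ρ ^ 2 + z ^ 2))) / (ρ ^ 2 + z ^ 2) = -1 := by
      field_simp
    unfold refl3
    rw [zero_sub, zero_sub, inner_neg_right, real_inner_smul_right, hxx, hn, hc]
    module
  have hN : refl3 x 0 (-e3) = (2 * ρ * z / (ρ ^ 2 + z ^ 2)) • ρhat
      + ((z ^ 2 - ρ ^ 2) / (ρ ^ 2 + z ^ 2)) • e3 := by
    have hc : (z ^ 2 - ρ ^ 2) / (ρ ^ 2 + z ^ 2) = -1 + 2 * z / (ρ ^ 2 + z ^ 2) * z := by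
      field_simp
      ring
    unfold refl3
    rw [sub_zero, inner_neg_right, hxe, hn, hc]
    simp only [x]
    module
  rw [hD, hN]
  constructor
  · rintro ⟨t, ht⟩
    have h1 := congrArg (fun v => ⟪ρhat, v⟫) ht
    have h2 := congrArg (fun v => ⟪e3, v⟫) ht
    simp only [T, x, inner_add_right, real_inner_smul_right, hee, hrr, hperp, hperp'] at h1 h2
    have h1' : Tρ = ρ + t * (2 * ρ * z / (ρ ^ 2 + z ^ 2)) := by linarith
    have h2' : Tz = z + t * ((z ^ 2 - ρ ^ 2) / (ρ ^ 2 + z ^ 2)) := by linarith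
    rw [h1', h2']
    field_simp
    ring
  · intro h
    refine ⟨((Tρ - ρ) * (2 * ρ * z) + (Tz - z) * (z ^ 2 - ρ ^ 2)) / (ρ ^ 2 + z ^ 2), ?_⟩
    have h1 : Tρ = ρ + ((Tρ - ρ) * (2 * ρ * z) + (Tz - z) * (z ^ 2 - ρ ^ 2)) / (ρ ^ 2 + z ^ 2)
        * (2 * ρ * z / (ρ ^ 2 + z ^ 2)) := by
      field_simp
      linear_combination (z ^ 2 - ρ ^ 2) * h
    have h2 : Tz = z + ((Tρ - ρ) * (2 * ρ * z) + (Tz - z) * (z ^ 2 - ρ ^ 2)) / (ρ ^ 2 + z ^ 2)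
        * ((z ^ 2 - ρ ^ 2) / (ρ ^ 2 + z ^ 2)) := by
      field_simp
      linear_combination (-2 * ρ * z) * h
    generalize ((Tρ - ρ) * (2 * ρ * z) + (Tz - z) * (z ^ 2 - ρ ^ 2)) / (ρ ^ 2 + z ^ 2) = t at *
    simp only [T, x]
    rw [h1, h2]
    module
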